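/- arXiv:2409.20457 — 4 statements merged into one kernel-verified Lean document; each statement's English description precedes it below -/
import Mathlib

section
/- Let ρ > ρ' > 1 and let h ∈ ℓ¹_ρ with Chebyshev coefficients (h_k). Then the derivative h' belongs to ℓ¹_{ρ'} and its Chebyshev expansion is h' = 2[ (∑_{l=0}^∞ (2l+1) h_{2l+1}) T_0 + 2 ∑_{k=1}^∞ ( ∑_{l=0}^∞ (k+2l+1) h_{k+2l+1} ) T_k ]. -/
open scoped BigOperators

/-- Evaluation of the `k`-th Chebyshev polynomial of the first kind at a real point. -/
noncomputable def chebT (k : ℕ) (x : ℝ) : ℝ := (Polynomial.Chebyshev.T ℝ (k : ℤ)).eval x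

/-- The function `h = h₀ + 2∑_{k≥1} h_k T_k` determined by a sequence of Chebyshev
coefficients. -/
noncomputable def chebFun (h : ℕ → ℝ) (x : ℝ) : ℝ :=
  h 0 + 2 * ∑' k : ℕ, h (k + 1) * chebT (k + 1) x

open Polynomial Polynomial.Chebyshev in
theorem abs_eval_T_le_pow {r x : ℝ} (hr : 1 ≤ r) (hx : |x| ≤ (r + r⁻¹) / 2) (n : ℕ) :
    |(T ℝ (n : ℤ)).eval x| ≤ r ^ n := by
  rcases le_total |x| 1 with h1 | h1
  · exact (abs_eval_T_real_le_one _ h1).trans (one_le_pow₀ hr)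
  wlog! h0 : 0 ≤ x
  · simpa [T_eval_neg, abs_mul, abs_unit_intCast] using
      this hr (x := -x) (by simpa using hx) n (by simpa using h1) (by linarith)
  rw [abs_of_nonneg h0] at hx h1
  have hr0 : 0 < r := by linarith
  have hlog : 0 ≤ Real.log r := Real.log_nonneg hr
  have ht : |Real.arcosh x| ≤ Real.log r := by
    rw [← abs_of_nonneg hlog, ← Real.cosh_le_cosh, Real.cosh_arcosh h1, Real.cosh_log hr0]
    exact hx
  rw [← Real.cosh_arcosh h1, T_real_cosh, abs_of_pos (Real.cosh_pos _)]
  calc Real.cosh ((n : ℤ) * Real.arcosh x) ≤ Real.cosh (n * Real.log r) := by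
        rw [Real.cosh_le_cosh, abs_mul, abs_mul, abs_of_nonneg hlog, Int.cast_natCast]
        gcongr
    _ ≤ Real.exp (n * Real.log r) := by
        rw [Real.cosh_eq]
        have : Real.exp (-(n * Real.log r)) ≤ Real.exp (n * Real.log r) :=
          Real.exp_le_exp.2 (by have : 0 ≤ n * Real.log r := by positivity
                                linarith)
        linarith
    _ = r ^ n := by rw [Real.exp_nat_mul, Real.exp_log hr0]

open Polynomial Polynomial.Chebyshev in
theorem abs_eval_U_le {r x : ℝ} (hr : 1 ≤ r) (hx : |x| ≤ (r + r⁻¹) / 2) (n : ℕ) :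
    |(U ℝ (n : ℤ)).eval x| ≤ (n + 1) * r ^ n := by
  induction n using Nat.twoStepInduction with
  | zero => simp
  | one =>
    have h := abs_eval_T_le_pow hr hx 1
    simp only [Nat.cast_one, T_one, eval_X, pow_one] at h
    simp only [Nat.cast_one, U_one, eval_mul, eval_X, eval_ofNat, abs_mul, abs_two, pow_one]
    linarith
  | more n ih _ =>
    have hT := abs_eval_T_le_pow hr hx (n + 2)
    have hpow : r ^ n ≤ r ^ (n + 2) := pow_le_pow_right₀ hr (by omega)
    push_cast at hT ⊢
    rw [U_eq_two_mul_T_add_U]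
    simp only [eval_add, eval_mul, eval_ofNat]
    calc |2 * (T ℝ ((n : ℤ) + 2)).eval x + (U ℝ (n : ℤ)).eval x|
        ≤ 2 * |(T ℝ ((n : ℤ) + 2)).eval x| + |(U ℝ (n : ℤ)).eval x| := by
          refine (abs_add_le _ _).trans ?_
          rw [abs_mul, abs_two]
      _ ≤ 2 * r ^ (n + 2) + (n + 1) * r ^ (n + 2) := by
          gcongr
          exact ih.trans (by gcongr)
      _ = ((n : ℝ) + 2 + 1) * r ^ (n + 2) := by ring

theorem summable_add_one_mul_geometric {q : ℝ} (hq : 0 ≤ q) (hq1 : q < 1) :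
    Summable fun k : ℕ => ((k : ℝ) + 1) * q ^ k := by
  have hn : ‖q‖ < 1 := by rwa [Real.norm_of_nonneg hq]
  have h := (summable_pow_mul_geometric_of_norm_lt_one 1 hn).add
    (summable_geometric_of_lt_one hq hq1)
  refine h.congr fun k => ?_
  ring

open Filter Topology in
theorem exists_abs_natCast_mul_le_geometric {ρ q : ℝ} (hρ : 0 < ρ) (hq : 0 < q) (hρq : 1 < ρ * q)
    {h : ℕ → ℝ} (hsum : Summable fun k => |h k| * ρ ^ k) :
    ∃ C : ℝ, ∀ k : ℕ, |(k : ℝ) * h k| ≤ C * q ^ k := by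
  have hlim := hsum.tendsto_atTop_zero.mul
    (tendsto_self_mul_const_pow_of_lt_one (r := (ρ * q)⁻¹) (by positivity)
      (inv_lt_one_of_one_lt₀ hρq))
  obtain ⟨C, hC⟩ := hlim.bddAbove_range
  refine ⟨C, fun k => ?_⟩
  have hk : |h k| * ρ ^ k * (k * (ρ * q)⁻¹ ^ k) ≤ C := hC ⟨k, rfl⟩
  calc |(k : ℝ) * h k| = |h k| * ρ ^ k * (k * (ρ * q)⁻¹ ^ k) * q ^ k := by
        have hk1 : ρ ^ k * ((ρ * q)⁻¹ ^ k * q ^ k) = 1 := by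
          rw [← mul_pow, ← mul_pow, mul_inv, mul_assoc, inv_mul_cancel₀ hq.ne', mul_one,
            mul_inv_cancel₀ hρ.ne', one_pow]
        rw [abs_mul, Nat.abs_cast]
        linear_combination -(k * |h k|) * hk1
    _ ≤ C * q ^ k := by gcongr

theorem summable_odd_tail {a : ℕ → ℝ} {C q : ℝ} (hq : 0 ≤ q) (hq1 : q < 1)
    (ha : ∀ k, |a k| ≤ C * q ^ k) (k : ℕ) : Summable fun l : ℕ => a (k + 2 * l + 1) := by
  have h : Summable a :=
    .of_norm_bounded ((summable_geometric_of_lt_one hq hq1).mul_left C) ha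
  exact h.comp_injective (i := fun l : ℕ => k + 2 * l + 1) fun l m hlm => by
    simp only at hlm
    omega

theorem tsum_odd_tail_eq {a : ℕ → ℝ} {C q : ℝ} (hq : 0 ≤ q) (hq1 : q < 1)
    (ha : ∀ k, |a k| ≤ C * q ^ k) (k : ℕ) :
    ∑' l : ℕ, a (k + 2 * l + 1) = a (k + 1) + ∑' l : ℕ, a (k + 2 + 2 * l + 1) := by
  rw [(summable_odd_tail hq hq1 ha k).tsum_eq_zero_add]
  congr 1
  refine tsum_congr fun l => ?_
  congr 1
  ring

theorem abs_tsum_odd_tail_le {a : ℕ → ℝ} {C q : ℝ} (hq : 0 ≤ q) (hq1 : q < 1)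
    (ha : ∀ k, |a k| ≤ C * q ^ k) (k : ℕ) :
    |∑' l : ℕ, a (k + 2 * l + 1)| ≤ C * q * (1 - q ^ 2)⁻¹ * q ^ k := by
  have hg : HasSum (fun l : ℕ => C * q ^ (k + 1) * (q ^ 2) ^ l)
      (C * q ^ (k + 1) * (1 - q ^ 2)⁻¹) :=
    (hasSum_geometric_of_lt_one (by positivity) (pow_lt_one₀ hq hq1 two_ne_zero)).mul_left _
  have hle := tsum_of_norm_bounded hg (f := fun l : ℕ => a (k + 2 * l + 1)) fun l =>
    (ha _).trans_eq (by ring)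
  exact hle.trans_eq (by ring)

open Polynomial Polynomial.Chebyshev in
theorem hasDerivAt_chebFun {h : ℕ → ℝ} {C q r x : ℝ} (hq : 0 < q) (hr : 1 < r) (hqr : q * r < 1)
    (hC : ∀ k : ℕ, |(k : ℝ) * h k| ≤ C * q ^ k) (hx : |x| ≤ (r + r⁻¹) / 2) :
    HasDerivAt (chebFun h)
      (2 * ∑' k : ℕ, ((k + 1 : ℕ) : ℝ) * h (k + 1) * (U ℝ (k : ℤ)).eval x) x := by
  obtain ⟨s, hrs, hsq⟩ : ∃ s, r < s ∧ s < q⁻¹ :=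
    exists_between ((lt_inv_mul_iff₀ hq).2 hqr |>.trans_eq (mul_one _))
  have hs : 1 < s := hr.trans hrs
  have hqs : q * s < 1 := by
    have := mul_lt_mul_of_pos_left hsq hq
    rwa [mul_inv_cancel₀ hq.ne'] at this
  have hxs : |x| < (s + s⁻¹) / 2 := by
    refine hx.trans_lt ?_
    have hlog : Real.cosh (Real.log r) < Real.cosh (Real.log s) := by
      rw [Real.cosh_lt_cosh, abs_of_pos (Real.log_pos hr), abs_of_pos (Real.log_pos hs)]
      exact Real.log_lt_log (by linarith) hrs
    rwa [Real.cosh_log (by linarith), Real.cosh_log (by linarith)] at hlog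
  have hsum : Summable fun k : ℕ => C * q * (((k : ℝ) + 1) * (q * s) ^ k) :=
    (summable_add_one_mul_geometric (by positivity) hqs).mul_left _
  have key := hasDerivAt_tsum_of_isPreconnected
    (g := fun k y => h (k + 1) * chebT (k + 1) y)
    (g' := fun k y => ((k + 1 : ℕ) : ℝ) * h (k + 1) * (U ℝ (k : ℤ)).eval y)
    (t := Set.Ioo (-((s + s⁻¹) / 2)) ((s + s⁻¹) / 2)) (y₀ := x) (y := x)
    hsum isOpen_Ioo isPreconnected_Ioo ?_ ?_ (abs_lt.1 hxs) ?_ (abs_lt.1 hxs)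
  · exact (key.const_mul 2).const_add (h 0)
  · intro k y _
    have hd := ((T ℝ ((k + 1 : ℕ) : ℤ)).hasDerivAt y).const_mul (h (k + 1))
    refine hd.congr_deriv ?_
    rw [T_derivative_eq_U]
    simp only [Nat.cast_add, Nat.cast_one, add_sub_cancel_right, eval_mul, eval_add, eval_one,
      Int.cast_add, Int.cast_natCast, Int.cast_one, eval_natCast]
    ring
  · intro k y hy
    rw [norm_mul, Real.norm_eq_abs, Real.norm_eq_abs]
    calc _ ≤ C * q ^ (k + 1) * ((k + 1) * s ^ k) :=
          mul_le_mul (hC _) (abs_eval_U_le hs.le (abs_lt.2 hy).le k) (abs_nonneg _)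
            ((abs_nonneg _).trans (hC _))
      _ = _ := by ring
  · refine .of_norm_bounded
      ((summable_geometric_of_lt_one (by positivity) hqs).mul_left (C * (q * s))) fun k => ?_
    rw [norm_mul, Real.norm_eq_abs, Real.norm_eq_abs]
    have hle : |h (k + 1)| ≤ C * q ^ (k + 1) := by
      refine le_trans ?_ (hC (k + 1))
      rw [abs_mul, Nat.abs_cast]
      exact le_mul_of_one_le_left (abs_nonneg _) (by simp)
    calc _ ≤ C * q ^ (k + 1) * s ^ (k + 1) :=
          mul_le_mul hle (abs_eval_T_le_pow hs.le hxs.le (k + 1)) (abs_nonneg _)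
            ((abs_nonneg _).trans hle)
      _ = _ := by ring

open Polynomial Polynomial.Chebyshev in
theorem tsum_sub_mul_eval_U_eq_chebFun {c : ℕ → ℝ} {x : ℝ}
    (hc : Summable fun k : ℕ => c k * (U ℝ (k : ℤ)).eval x)
    (hc' : Summable fun k : ℕ => c (k + 2) * (U ℝ (k : ℤ)).eval x) :
    ∑' k : ℕ, (c k - c (k + 2)) * (U ℝ (k : ℤ)).eval x = chebFun c x := by
  have h2 := (summable_nat_add_iff 2).2 hc
  have hT : ∀ k : ℕ, c (k + 2) * (U ℝ ((k + 2 : ℕ) : ℤ)).eval x -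
      c (k + 2) * (U ℝ (k : ℤ)).eval x = 2 * (c (k + 2) * chebT (k + 2) x) := fun k => by
    rw [chebT]
    push_cast
    rw [U_eq_two_mul_T_add_U]
    simp only [eval_add, eval_mul, eval_ofNat]
    ring
  have hsT : Summable fun k : ℕ => c (k + 2) * chebT (k + 2) x :=
    (summable_mul_left_iff two_ne_zero).1 ((h2.sub hc').congr hT)
  have hsT1 : Summable fun k : ℕ => c (k + 1) * chebT (k + 1) x :=
    (summable_nat_add_iff 1).1 hsT
  calc ∑' k : ℕ, (c k - c (k + 2)) * (U ℝ (k : ℤ)).eval x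
      = ∑' k : ℕ, c k * (U ℝ (k : ℤ)).eval x - ∑' k : ℕ, c (k + 2) * (U ℝ (k : ℤ)).eval x := by
        rw [← hc.tsum_sub hc']
        simp only [sub_mul]
    _ = c 0 + c 1 * (2 * x) + ∑' k : ℕ, 2 * (c (k + 2) * chebT (k + 2) x) := by
        rw [← hc.sum_add_tsum_nat_add 2, add_sub_assoc, ← h2.tsum_sub hc', tsum_congr hT]
        simp [Finset.sum_range_succ]
    _ = chebFun c x := by
        have hx1 : chebT (0 + 1) x = x := by simp [chebT]
        rw [chebFun, hsT1.tsum_eq_zero_add, tsum_mul_left, hx1]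
        ring

/-- Let `ρ > ρ' > 1` and `h ∈ ℓ¹_ρ` with Chebyshev coefficients `(h_k)`.
Then `h'` belongs to `ℓ¹_{ρ'}`, with Chebyshev expansion
`h' = 2[(∑_{l≥0} (2l+1) h_{2l+1}) T₀ + 2 ∑_{k≥1} (∑_{l≥0} (k+2l+1) h_{k+2l+1}) T_k]`. -/
theorem deriv_chebFun_expansion (ρ ρ' : ℝ) (hρ' : 1 < ρ') (hρ : ρ' < ρ)
    (h : ℕ → ℝ) (hsum : Summable fun k => |h k| * ρ ^ k) :
    -- the Chebyshev coefficients of `h'`, in the normalization `h' = c₀ + 2∑_{k≥1} c_k T_k`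
    let c : ℕ → ℝ := fun k => 2 * ∑' l : ℕ, ((k + 2 * l + 1 : ℕ) : ℝ) * h (k + 2 * l + 1)
    -- `h' ∈ ℓ¹_{ρ'}` :
    (Summable fun k => |c k| * ρ' ^ k) ∧
    -- and `h'` is given by the stated Chebyshev series, on `E_{ρ'} ∩ ℝ` :
    (∀ x : ℝ, |x| ≤ (ρ' + ρ'⁻¹) / 2 →
      HasDerivAt (chebFun h) (chebFun c x) x) := by
  intro c
  have h0' : 0 < ρ' := by linarith
  obtain ⟨r, hr', hr⟩ := exists_between hρ
  have hr0 : 0 < r := by linarith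
  have hq : 0 < r⁻¹ := by positivity
  have hq1 : r⁻¹ < 1 := inv_lt_one_of_one_lt₀ (by linarith)
  have hqρ' : r⁻¹ * ρ' < 1 := by rwa [inv_mul_lt_one₀ hr0]
  obtain ⟨C, hC⟩ := exists_abs_natCast_mul_le_geometric (q := r⁻¹) (by linarith) hq
    (by rwa [← div_eq_mul_inv, one_lt_div hr0]) hsum
  obtain ⟨D, hD⟩ : ∃ D, ∀ k, |c k| ≤ D * r⁻¹ ^ k :=
    ⟨2 * (C * r⁻¹ * (1 - r⁻¹ ^ 2)⁻¹), fun k => by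
      simp only [c]
      rw [abs_mul, abs_two, mul_assoc 2]
      gcongr
      exact abs_tsum_odd_tail_le hq.le hq1 hC k⟩
  have hrec : ∀ k, c k - c (k + 2) = 2 * (((k + 1 : ℕ) : ℝ) * h (k + 1)) := fun k => by
    simp only [c]
    rw [tsum_odd_tail_eq hq.le hq1 hC k]
    ring
  refine ⟨?_, fun x hx => ?_⟩
  · refine .of_nonneg_of_le (fun k => by positivity) (fun k => ?_)
      ((summable_geometric_of_lt_one (by positivity) hqρ').mul_left D)
    rw [mul_pow, ← mul_assoc]
    gcongr
    exact hD k
  · have hU : ∀ m : ℕ, Summable fun k : ℕ =>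
        c (k + m) * (Polynomial.Chebyshev.U ℝ (k : ℤ)).eval x := fun m => by
      refine .of_norm_bounded
        ((summable_add_one_mul_geometric (by positivity) hqρ').mul_left (D * r⁻¹ ^ m)) fun k => ?_
      rw [norm_mul, Real.norm_eq_abs, Real.norm_eq_abs]
      calc _ ≤ D * r⁻¹ ^ (k + m) * ((k + 1) * ρ' ^ k) :=
            mul_le_mul (hD _) (abs_eval_U_le hρ'.le hx k) (abs_nonneg _)
              ((abs_nonneg _).trans (hD _))
        _ = _ := by ring
    refine (hasDerivAt_chebFun hq hρ' hqρ' hC hx).congr_deriv ?_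
    rw [← tsum_sub_mul_eval_U_eq_chebFun (c := c) (hU 0) (hU 2), ← tsum_mul_left]
    refine tsum_congr fun k => ?_
    rw [hrec]
    ring
end

section
/- Let 1 < ρ < ν, set σ^even_{ρ,ν} = sup_{n≥1} s(n) where s(n) = (2n/ν^{2n})·( ρ(ρ^{2n}−1)/(ρ²−1) + ρ^{−1}(ρ^{−2n}−1)/(ρ^{−2}−1) ), and let n_0 ∈ ℕ_{≥1} satisfy n_0 ≥ 1/(2(ln ν − ln ρ)). Then σ^even_{ρ,ν} ≤ max( max_{1≤n≤n_0−1} s(n), t(n_0) ) where t(n_0) = (2n_0/ν^{2n_0})·( ρ^{2n_0}·ρ/(ρ²−1) + ρ^{−1}/(1−ρ^{−2}) ). Moreover, if max_{1≤n≤n_0−1} s(n) ≥ t(n_0), then σ^even_{ρ,ν} = max_{1≤n≤n_0−1} s(n). -/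
/-- The summand `s(n)` appearing in `σ^even_{ρ,ν}`. -/
noncomputable def sigmaEvenTerm (ρ ν : ℝ) (n : ℕ) : ℝ :=
  (2 * n / ν ^ (2 * n)) *
    (ρ * ((ρ ^ (2 * n) - 1) / (ρ ^ 2 - 1)) + ρ⁻¹ * ((ρ⁻¹ ^ (2 * n) - 1) / (ρ⁻¹ ^ 2 - 1)))

/-- `σ^even_{ρ,ν} = sup_{n ≥ 1} s(n)`. -/
noncomputable def sigmaEven (ρ ν : ℝ) : ℝ := ⨆ n : ℕ, sigmaEvenTerm ρ ν (n + 1)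

/-- The tail bound `t(n₀)`. -/
noncomputable def sigmaEvenTail (ρ ν : ℝ) (n₀ : ℕ) : ℝ :=
  (2 * n₀ / ν ^ (2 * n₀)) *
    (ρ ^ (2 * n₀) * (ρ / (ρ ^ 2 - 1)) + ρ⁻¹ / (1 - ρ⁻¹ ^ 2))

/-- The sequence `n / x ^ (2 * n)` is antitone from `m` on as soon as `1 ≤ 2 * m * log x`. -/
theorem div_pow_two_mul_le_of_le {x : ℝ} (hx : 1 < x) {m n : ℕ} (hmn : m ≤ n)
    (hm : 1 ≤ 2 * m * Real.log x) : (n : ℝ) / x ^ (2 * n) ≤ m / x ^ (2 * m) := by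
  have hx0 : 0 < x := by linarith
  have hlog : 0 < Real.log x := Real.log_pos hx
  induction n, hmn using Nat.le_induction with
  | base => exact le_rfl
  | succ n hmn ih =>
    refine le_trans ?_ ih
    have hmn' : (m : ℝ) ≤ n := by exact_mod_cast hmn
    have hsq : 1 + 2 * Real.log x ≤ x ^ 2 := by
      have h := Real.add_one_le_exp (Real.log (x ^ 2))
      rw [Real.exp_log (by positivity), Real.log_pow] at h
      push_cast at h
      linarith
    have hstep : (n : ℝ) + 1 ≤ n * x ^ 2 := by
      nlinarith [mul_le_mul_of_nonneg_left hsq (Nat.cast_nonneg (α := ℝ) n),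
        mul_le_mul_of_nonneg_right hmn' hlog.le]
    rw [div_le_div_iff₀ (by positivity) (by positivity)]
    calc ((n + 1 : ℕ) : ℝ) * x ^ (2 * n) ≤ n * x ^ 2 * x ^ (2 * n) := by
          push_cast
          gcongr
      _ = n * x ^ (2 * (n + 1)) := by ring

theorem sigmaEvenTerm_nonneg {ρ ν : ℝ} (hρ : 1 < ρ) (hρν : ρ < ν) (n : ℕ) :
    0 ≤ sigmaEvenTerm ρ ν n := by
  have hρ0 : 0 < ρ := by linarith
  have hν0 : 0 < ν := by linarith
  have hinv : ρ⁻¹ < 1 := inv_lt_one_of_one_lt₀ hρ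
  have h1 : 1 ≤ ρ ^ (2 * n) := one_le_pow₀ hρ.le
  have h2 : 1 ≤ ρ ^ 2 := one_le_pow₀ hρ.le
  have h3 : ρ⁻¹ ^ (2 * n) ≤ 1 := pow_le_one₀ (by positivity) hinv.le
  have h4 : ρ⁻¹ ^ 2 ≤ 1 := pow_le_one₀ (by positivity) hinv.le
  have h5 : 0 ≤ (ρ ^ (2 * n) - 1) / (ρ ^ 2 - 1) := div_nonneg (by linarith) (by linarith)
  have h6 : 0 ≤ (ρ⁻¹ ^ (2 * n) - 1) / (ρ⁻¹ ^ 2 - 1) :=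
    div_nonneg_of_nonpos (by linarith) (by linarith)
  unfold sigmaEvenTerm
  positivity

theorem sigmaEvenTerm_le_sigmaEvenTail {ρ ν : ℝ} (hρ : 1 < ρ) (hρν : ρ < ν) (n : ℕ) :
    sigmaEvenTerm ρ ν n ≤ sigmaEvenTail ρ ν n := by
  have hρ0 : 0 < ρ := by linarith
  have hν0 : 0 < ν := by linarith
  have h2 : 0 < ρ ^ 2 - 1 := sub_pos.2 (one_lt_pow₀ hρ two_ne_zero)
  have h4 : 0 < 1 - ρ⁻¹ ^ 2 :=
    sub_pos.2 (pow_lt_one₀ (by positivity) (inv_lt_one_of_one_lt₀ hρ) two_ne_zero)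
  unfold sigmaEvenTerm sigmaEvenTail
  refine mul_le_mul_of_nonneg_left (add_le_add ?_ ?_) (by positivity)
  · rw [← mul_div_assoc, ← mul_div_assoc]
    refine div_le_div_of_nonneg_right ?_ h2.le
    linarith
  · rw [← neg_div_neg_eq (ρ⁻¹ ^ (2 * n) - 1), neg_sub, neg_sub, ← mul_div_assoc]
    gcongr
    have : 0 ≤ ρ⁻¹ * ρ⁻¹ ^ (2 * n) := by positivity
    linarith

theorem sigmaEvenTail_le_of_le {ρ ν : ℝ} (hρ : 1 < ρ) (hρν : ρ < ν) {m n : ℕ} (hmn : m ≤ n)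
    (hm : (m : ℝ) ≥ 1 / (2 * (Real.log ν - Real.log ρ))) :
    sigmaEvenTail ρ ν n ≤ sigmaEvenTail ρ ν m := by
  have hρ0 : 0 < ρ := by linarith
  have hν0 : 0 < ν := by linarith
  have h2 : 0 < ρ ^ 2 - 1 := sub_pos.2 (one_lt_pow₀ hρ two_ne_zero)
  have h4 : 0 < 1 - ρ⁻¹ ^ 2 :=
    sub_pos.2 (pow_lt_one₀ (by positivity) (inv_lt_one_of_one_lt₀ hρ) two_ne_zero)
  have hlog : 0 < Real.log ν - Real.log ρ := sub_pos.2 (Real.log_lt_log hρ0 hρν)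
  have hlogρ : 0 < Real.log ρ := Real.log_pos hρ
  have hm1 : 1 ≤ 2 * m * (Real.log ν - Real.log ρ) := by
    rw [ge_iff_le, div_le_iff₀ (by positivity)] at hm
    linarith
  have hm2 : 1 ≤ 2 * m * Real.log ν := by
    nlinarith [mul_nonneg (Nat.cast_nonneg (α := ℝ) m) hlogρ.le]
  have hquot := div_pow_two_mul_le_of_le ((one_lt_div hρ0).2 hρν) hmn
    (by rwa [Real.log_div hν0.ne' hρ0.ne'])
  have hν := div_pow_two_mul_le_of_le (hρ.trans hρν) hmn hm2
  have key (k : ℕ) : sigmaEvenTail ρ ν k =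
      2 * (k / (ν / ρ) ^ (2 * k) * (ρ / (ρ ^ 2 - 1)) +
        k / ν ^ (2 * k) * (ρ⁻¹ / (1 - ρ⁻¹ ^ 2))) := by
    unfold sigmaEvenTail
    rw [div_pow, div_div_eq_mul_div]
    ring
  rw [key, key]
  gcongr

theorem Real.le_biSup_finset_of_nonneg {ι : Type*} {f : ι → ℝ} (hf : ∀ i, 0 ≤ f i)
    {s : Finset ι} {i : ι} (hi : i ∈ s) : f i ≤ ⨆ j ∈ s, f j := by
  have hbdd : BddAbove (Set.range fun j => ⨆ _ : j ∈ s, f j) := by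
    refine ⟨∑ j ∈ s, f j, ?_⟩
    rintro _ ⟨j, rfl⟩
    exact Real.iSup_le (fun hj => Finset.single_le_sum (fun k _ => hf k) hj)
      (Finset.sum_nonneg fun k _ => hf k)
  refine le_trans ?_ (le_ciSup hbdd i)
  simp [hi]

/-- **computable upper bound for `σ^even_{ρ,ν}`.** Let `1 < ρ < ν` and
`n₀ ≥ 1` with `n₀ ≥ 1/(2(ln ν − ln ρ))`.  Then
`σ^even_{ρ,ν} ≤ max(max_{1 ≤ n ≤ n₀-1} s(n), t(n₀))`; moreover if
`max_{1 ≤ n ≤ n₀-1} s(n) ≥ t(n₀)` then `σ^even_{ρ,ν} = max_{1 ≤ n ≤ n₀-1} s(n)`. -/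
theorem sigmaEven_computable_bound (ρ ν : ℝ) (hρ : 1 < ρ) (hρν : ρ < ν)
    (n₀ : ℕ) (hn₀ : 1 ≤ n₀) (hn₀' : (n₀ : ℝ) ≥ 1 / (2 * (Real.log ν - Real.log ρ))) :
    sigmaEven ρ ν ≤
      max (⨆ n ∈ Finset.Icc 1 (n₀ - 1), sigmaEvenTerm ρ ν n) (sigmaEvenTail ρ ν n₀) ∧
    ((⨆ n ∈ Finset.Icc 1 (n₀ - 1), sigmaEvenTerm ρ ν n) ≥ sigmaEvenTail ρ ν n₀ →
      sigmaEven ρ ν = ⨆ n ∈ Finset.Icc 1 (n₀ - 1), sigmaEvenTerm ρ ν n) := by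
  have hterm (n : ℕ) : sigmaEvenTerm ρ ν (n + 1) ≤
      max (⨆ n ∈ Finset.Icc 1 (n₀ - 1), sigmaEvenTerm ρ ν n) (sigmaEvenTail ρ ν n₀) := by
    rcases lt_or_ge (n + 1) n₀ with h | h
    · exact le_max_of_le_left (Real.le_biSup_finset_of_nonneg (sigmaEvenTerm_nonneg hρ hρν)
        (Finset.mem_Icc.2 ⟨by omega, by omega⟩))
    · exact le_max_of_le_right ((sigmaEvenTerm_le_sigmaEvenTail hρ hρν _).trans
        (sigmaEvenTail_le_of_le hρ hρν h hn₀'))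
  have hle : sigmaEven ρ ν ≤
      max (⨆ n ∈ Finset.Icc 1 (n₀ - 1), sigmaEvenTerm ρ ν n) (sigmaEvenTail ρ ν n₀) :=
    ciSup_le hterm
  refine ⟨hle, fun hmax => le_antisymm (hle.trans_eq (max_eq_left hmax)) ?_⟩
  have hnonneg : 0 ≤ sigmaEven ρ ν := Real.iSup_nonneg fun n => sigmaEvenTerm_nonneg hρ hρν _
  have hbdd : BddAbove (Set.range fun n : ℕ => sigmaEvenTerm ρ ν (n + 1)) :=
    ⟨_, Set.forall_mem_range.2 hterm⟩
  refine Real.iSup_le (fun n => Real.iSup_le (fun hn => ?_) hnonneg) hnonneg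
  obtain ⟨k, rfl⟩ := Nat.exists_eq_add_of_le' (Finset.mem_Icc.1 hn).1
  exact le_ciSup hbdd k
end

section
/- Let ρ ≥ 1, K ∈ ℕ_{≥1}, and h ∈ ℓ¹_ρ. Then the Chebyshev interpolation polynomial satisfies ‖Π^K h‖_{ℓ¹_ρ} ≤ ‖h‖_{ℓ¹_ρ}. -/
open scoped BigOperators

/-- The Chebyshev nodes `x_j = cos((K - j)π/K)`, `0 ≤ j ≤ K`. -/
noncomputable def chebNode (K j : ℕ) : ℝ := Real.cos (((K : ℝ) - (j : ℝ)) * Real.pi / (K : ℝ))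

/-- The `ℓ¹_ρ` norm of a sequence of Chebyshev coefficients. -/
noncomputable def ell1norm (ρ : ℝ) (h : ℕ → ℝ) : ℝ :=
  |h 0| + 2 * ∑' k : ℕ, |h (k + 1)| * ρ ^ (k + 1)

open Polynomial.Chebyshev in
lemma chebT_cos (k : ℕ) (θ : ℝ) : chebT k (Real.cos θ) = Real.cos (k * θ) := by
  simp [chebT, T_real_cos]

lemma abs_chebT_chebNode_le_one (k K j : ℕ) : |chebT k (chebNode K j)| ≤ 1 := by
  rw [chebNode, chebT_cos]
  exact Real.abs_cos_le_one _

lemma chebNode_injOn {K : ℕ} (hK : 1 ≤ K) :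
    Set.InjOn (chebNode K) (Finset.range (K + 1)) := by
  have hK0 : (0 : ℝ) < K := by exact_mod_cast hK
  have mem : ∀ j ∈ Finset.range (K + 1),
      ((K : ℝ) - j) * Real.pi / K ∈ Set.Icc 0 Real.pi := by
    intro j hj
    have hj' : (j : ℝ) ≤ K := by exact_mod_cast Finset.mem_range_succ_iff.mp hj
    have hpi := Real.pi_pos
    refine ⟨by have := sub_nonneg.mpr hj'; positivity, ?_⟩
    rw [div_le_iff₀ hK0, mul_comm]
    exact mul_le_mul_of_nonneg_left (by linarith [(Nat.cast_nonneg j : (0 : ℝ) ≤ j)]) hpi.le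
  intro i hi j hj hij
  have h := Real.injOn_cos (mem i hi) (mem j hj) hij
  field_simp at h
  exact_mod_cast (by linarith : (i : ℝ) = j)

/-- Aliasing: on the nodes, `T_{2K-k}` and `T_k` agree. -/
lemma chebT_natAbs_two_mul_sub_chebNode {K : ℕ} (hK : 1 ≤ K) (k : ℕ) {j : ℕ} (hj : j ≤ K) :
    chebT (2 * K - k : ℤ).natAbs (chebNode K j) = chebT k (chebNode K j) := by
  have hK0 : (K : ℝ) ≠ 0 := by positivity
  rw [chebT, Polynomial.Chebyshev.T_natAbs, chebNode, Polynomial.Chebyshev.T_real_cos, chebT_cos]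
  have h : ((2 * K - k : ℤ) : ℝ) * (((K : ℝ) - j) * Real.pi / K) =
      ((K - j : ℕ) : ℝ) * (2 * Real.pi) - k * (((K : ℝ) - j) * Real.pi / K) := by
    push_cast [Nat.cast_sub hj]
    field_simp
  rw [h, Real.cos_nat_mul_two_pi_sub]

lemma exists_alias {K : ℕ} (hK : 1 ≤ K) (k : ℕ) :
    ∃ m ≤ K, m ≤ k ∧ ∀ j ≤ K, chebT k (chebNode K j) = chebT m (chebNode K j) := by
  induction k using Nat.strong_induction_on with
  | h k ih =>
    rcases le_or_gt k K with hk | hk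
    · exact ⟨k, hk, le_rfl, fun _ _ => rfl⟩
    · obtain ⟨m, hmK, hm, h⟩ := ih (2 * K - k : ℤ).natAbs (by omega)
      exact ⟨m, hmK, by omega, fun j hj => by
        rw [← h j hj, chebT_natAbs_two_mul_sub_chebNode hK k hj]⟩

/-- A Chebyshev sum of degree at most `K` is determined by its values at the nodes. -/
lemma eq_of_sum_chebT_chebNode_eq {K : ℕ} (hK : 1 ≤ K) {a b : ℕ → ℝ}
    (hab : ∀ j ≤ K, ∑ m ∈ Finset.range (K + 1), a m * chebT m (chebNode K j) =
      ∑ m ∈ Finset.range (K + 1), b m * chebT m (chebNode K j)) :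
    ∀ m ∈ Finset.range (K + 1), a m = b m := by
  set p : Polynomial ℝ := ∑ m ∈ Finset.range (K + 1),
    (a m - b m) • Polynomial.Chebyshev.T ℝ (m : ℤ) with hp
  have hdeg : p.natDegree < ((Finset.range (K + 1)).image (chebNode K)).card := by
    rw [Finset.card_image_of_injOn (chebNode_injOn hK), Finset.card_range, Nat.lt_succ_iff]
    refine Polynomial.natDegree_sum_le_of_forall_le _ _ fun m hm => ?_
    refine (Polynomial.natDegree_smul_le _ _).trans ?_
    simpa using Finset.mem_range_succ_iff.mp hm
  have hp0 : p = 0 := by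
    refine Polynomial.eq_zero_of_natDegree_lt_card_of_eval_eq_zero' p _ ?_ hdeg
    intro x hx
    obtain ⟨j, hj, rfl⟩ := Finset.mem_image.mp hx
    have := hab j (Finset.mem_range_succ_iff.mp hj)
    simp only [chebT] at this
    simp [hp, Polynomial.eval_finsetSum, sub_mul, Finset.sum_sub_distrib, this]
  intro m hm
  exact sub_eq_zero.mp (linearIndependent_iff'.mp
    (Polynomial.Chebyshev.chebyshevTsequence ℝ).linearIndependent _ (fun m => a m - b m)
    hp0 m hm)

/-- The coefficients of `h` in the basis `T_k`, that is `h₀, 2h₁, 2h₂, …`. -/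
def chebWeight (h : ℕ → ℝ) (k : ℕ) : ℝ := if k = 0 then h 0 else 2 * h k

lemma summable_abs_chebWeight {ρ : ℝ} (hρ : 0 ≤ ρ) {h : ℕ → ℝ}
    (hsum : Summable fun k => |h k| * ρ ^ k) : Summable fun k => |chebWeight h k| * ρ ^ k := by
  refine Summable.of_nonneg_of_le (fun k => by positivity) (fun k => ?_) (hsum.mul_left 2)
  rw [← mul_assoc]
  refine mul_le_mul_of_nonneg_right ?_ (by positivity)
  rcases k with _ | k
  · simpa [chebWeight] using (by linarith [abs_nonneg (h 0)] : |h 0| ≤ 2 * |h 0|)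
  · simp [chebWeight, abs_mul]

lemma ell1norm_eq_tsum {ρ : ℝ} (hρ : 0 ≤ ρ) {h : ℕ → ℝ}
    (hsum : Summable fun k => |h k| * ρ ^ k) :
    ell1norm ρ h = ∑' k, |chebWeight h k| * ρ ^ k := by
  rw [(summable_abs_chebWeight hρ hsum).tsum_eq_zero_add, ell1norm, ← tsum_mul_left]
  simp [chebWeight, abs_mul, mul_assoc]

lemma chebFun_eq_tsum {h : ℕ → ℝ} {x : ℝ}
    (hsum : Summable fun k => chebWeight h k * chebT k x) :
    chebFun h x = ∑' k, chebWeight h k * chebT k x := by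
  rw [hsum.tsum_eq_zero_add, chebFun, ← tsum_mul_left]
  simp [chebWeight, mul_assoc, chebT]

lemma chebSum_eq_sum_range (c : ℕ → ℝ) (K : ℕ) (x : ℝ) :
    c 0 + 2 * ∑ k ∈ Finset.Icc 1 K, c k * chebT k x =
      ∑ k ∈ Finset.range (K + 1), chebWeight c k * chebT k x := by
  induction K with
  | zero => simp [chebWeight, chebT]
  | succ K ih =>
    rw [Finset.sum_range_succ, ← ih, Finset.sum_Icc_succ_top (by omega)]
    simp [chebWeight]
    ring

/-- Let `ρ ≥ 1`, `K ≥ 1` and `h ∈ ℓ¹_ρ`.  Then the Chebyshev interpolation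
polynomial satisfies `‖Π^K h‖_{ℓ¹_ρ} ≤ ‖h‖_{ℓ¹_ρ}`; here `c` denotes the sequence of Chebyshev
coefficients of `Π^K h` (vanishing beyond index `K`). -/
theorem ell1_interp_le (ρ : ℝ) (hρ : 1 ≤ ρ) (K : ℕ) (hK : 1 ≤ K)
    (h : ℕ → ℝ) (hsum : Summable fun k => |h k| * ρ ^ k)
    (c : ℕ → ℝ) (hc_deg : ∀ k, K < k → c k = 0)
    (hc_interp : ∀ j ≤ K,
      c 0 + 2 * ∑ k ∈ Finset.Icc 1 K, c k * chebT k (chebNode K j) = chebFun h (chebNode K j)) :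
    ell1norm ρ c ≤ ell1norm ρ h := by
  have hρ0 : 0 ≤ ρ := zero_le_one.trans hρ
  choose r hrK hrle hr using exists_alias hK
  set w := chebWeight h with hw
  have hsw : Summable fun k => |w k| * ρ ^ k := summable_abs_chebWeight hρ0 hsum
  have hsabs : Summable fun k => |w k| :=
    hsw.of_nonneg_of_le (fun k => abs_nonneg _)
      fun k => le_mul_of_one_le_right (abs_nonneg _) (one_le_pow₀ hρ)
  have hsite : ∀ m, Summable fun k => if r k = m then w k else 0 := fun m =>
    hsabs.of_norm_bounded fun k => by split_ifs <;> simp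
  have hfold : ∀ m ∈ Finset.range (K + 1),
      chebWeight c m = ∑' k, if r k = m then w k else 0 := by
    refine eq_of_sum_chebT_chebNode_eq hK fun j hj => ?_
    have hst : Summable fun k => w k * chebT k (chebNode K j) :=
      hsabs.of_norm_bounded fun k => by
        rw [norm_mul]
        exact mul_le_of_le_one_right (norm_nonneg _) (abs_chebT_chebNode_le_one _ _ _)
    rw [← chebSum_eq_sum_range, hc_interp j hj, chebFun_eq_tsum hst]
    simp_rw [← tsum_mul_right]
    rw [← Summable.tsum_finsetSum fun m _ => (hsite m).mul_right _]
    refine tsum_congr fun k => ?_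
    simp [ite_mul, hrK, hr k j hj, hw]
  have hsρ : ∀ m, Summable fun k => if r k = m then |w k| * ρ ^ k else 0 := fun m =>
    hsw.of_nonneg_of_le (fun k => by split_ifs <;> positivity)
      fun k => by split_ifs; exacts [le_rfl, by positivity]
  have hcz : ∀ m ∉ Finset.range (K + 1), c m = 0 := fun m hm =>
    hc_deg m (by simpa [Nat.lt_succ_iff] using hm)
  rw [ell1norm_eq_tsum hρ0 hsum, ell1norm_eq_tsum hρ0
    (summable_of_ne_finset_zero (s := Finset.range (K + 1)) fun m hm => by simp [hcz m hm]),
    tsum_eq_sum (s := Finset.range (K + 1)) fun m hm => by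
      have : m ≠ 0 := by rintro rfl; simp at hm
      simp [chebWeight, this, hcz m hm]]
  calc ∑ m ∈ Finset.range (K + 1), |chebWeight c m| * ρ ^ m
      ≤ ∑ m ∈ Finset.range (K + 1), ∑' k, if r k = m then |w k| * ρ ^ k else 0 := by
        refine Finset.sum_le_sum fun m hm => ?_
        rw [hfold m hm]
        have hsn : Summable fun k => ‖if r k = m then w k else 0‖ := (hsite m).norm
        refine (mul_le_mul_of_nonneg_right (norm_tsum_le_tsum_norm hsn) (by positivity)).trans ?_
        rw [← tsum_mul_right]
        refine (hsn.mul_right _).tsum_le_tsum (fun k => ?_) (hsρ m)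
        split_ifs with hk
        · exact mul_le_mul_of_nonneg_left (pow_le_pow_right₀ hρ (hk ▸ hrle k)) (abs_nonneg _)
        · simp
    _ = ∑' k, |w k| * ρ ^ k := by
        rw [← Summable.tsum_finsetSum fun m _ => hsρ m]
        refine tsum_congr fun k => ?_
        simp [hrK]
end

section
/- Newton–Kantorovich-type theorem: Let X be a real Banach space, x̄ ∈ X, r* ∈ (0, ∞], and let Φ : X → X be Fréchet differentiable on the closed ball B̄(x̄, r*). Let A : X → X be an injective bounded linear operator, and let Y, Z ≥ 0 satisfy ‖A Φ(x̄)‖ ≤ Y and ‖Id − A ∘ DΦ(x)‖_op ≤ Z for every x ∈ B̄(x̄, r*). If Z < 1, then for every r with Y/(1−Z) ≤ r ≤ r*, there exists a unique x* in the closed ball B̄(x̄, r) such that Φ(x*) = 0. -/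
open Metric
open scoped ENNReal

/-- A contraction on a closed ball of a Banach space which moves the centre by at most
`(1 - Z) * r` has a unique fixed point in that ball. -/
theorem existsUnique_isFixedPt_closedBall {X : Type*} [NormedAddCommGroup X] [CompleteSpace X]
    {T : X → X} {x₀ : X} {r Z : ℝ} (hZ0 : 0 ≤ Z) (hZ1 : Z < 1) (hr : 0 ≤ r)
    (hT : ∀ x ∈ closedBall x₀ r, ∀ y ∈ closedBall x₀ r, ‖T y - T x‖ ≤ Z * ‖y - x‖)
    (hx₀ : ‖T x₀ - x₀‖ ≤ (1 - Z) * r) :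
    ∃! x : X, x ∈ closedBall x₀ r ∧ Function.IsFixedPt T x := by
  have h₀ : x₀ ∈ closedBall x₀ r := mem_closedBall_self hr
  have hmaps : Set.MapsTo T (closedBall x₀ r) (closedBall x₀ r) := by
    intro x hx
    have h₁ := hT x₀ h₀ x hx
    have h₂ := norm_sub_le_norm_sub_add_norm_sub (T x) (T x₀) x₀
    rw [mem_closedBall, dist_eq_norm] at hx ⊢
    nlinarith
  have hcontr : ContractingWith ⟨Z, hZ0⟩ (hmaps.restrict T _ _) := by
    refine ⟨hZ1, LipschitzWith.of_dist_le_mul fun x y => ?_⟩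
    rw [Subtype.dist_eq, Subtype.dist_eq, dist_eq_norm, dist_eq_norm]
    exact hT y y.2 x x.2
  obtain ⟨x, hx, hfix, -⟩ :=
    hcontr.exists_fixedPoint' isClosed_closedBall.isComplete hmaps h₀ (edist_ne_top _ _)
  refine ⟨x, ⟨hx, hfix⟩, fun y ⟨hy, hyfix⟩ => ?_⟩
  have h := hT x hx y hy
  rw [hfix.eq, hyfix.eq] at h
  have : ‖y - x‖ = 0 := by nlinarith [norm_nonneg (y - x)]
  exact sub_eq_zero.mp (norm_eq_zero.mp this)

/-- **Newton–Kantorovich-type theorem.** Let `X` be a real Banach space,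
`x₀ ∈ X`, `r* ∈ (0, ∞]`, and `Φ : X → X` Fréchet differentiable on the closed ball
`B̄(x₀, r*)` with derivative `DΦ`.  Let `A` be an injective bounded linear operator on `X`,
and `Y, Z ≥ 0` with `‖AΦ(x₀)‖ ≤ Y` and `‖Id − A ∘ DΦ(x)‖ ≤ Z` for all `x ∈ B̄(x₀, r*)`.
If `Z < 1`, then for every `r` with `Y/(1-Z) ≤ r ≤ r*` there exists a unique `x*` in the
closed ball `B̄(x₀, r)` with `Φ(x*) = 0`. -/
theorem newton_kantorovich_zero {X : Type*} [NormedAddCommGroup X] [NormedSpace ℝ X]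
    [CompleteSpace X]
    (Φ : X → X) (x₀ : X) (rstar : ℝ≥0∞) (hrstar : 0 < rstar)
    (DΦ : X → X →L[ℝ] X)
    (hdiff : ∀ x ∈ EMetric.closedBall x₀ rstar,
      HasFDerivWithinAt Φ (DΦ x) (EMetric.closedBall x₀ rstar) x)
    (A : X →L[ℝ] X) (hA : Function.Injective A)
    (Y Z : ℝ) (hY0 : 0 ≤ Y) (hZ0 : 0 ≤ Z)
    (hY : ‖A (Φ x₀)‖ ≤ Y)
    (hZ : ∀ x ∈ EMetric.closedBall x₀ rstar, ‖ContinuousLinearMap.id ℝ X - A.comp (DΦ x)‖ ≤ Z)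
    (hZ1 : Z < 1) :
    ∀ r : ℝ, Y / (1 - Z) ≤ r → ENNReal.ofReal r ≤ rstar →
      ∃! x : X, x ∈ Metric.closedBall x₀ r ∧ Φ x = 0 := by
  intro r hYr hr
  have hr0 : 0 ≤ r := (div_nonneg hY0 (by linarith)).trans hYr
  have hsub : closedBall x₀ r ⊆ closedEBall x₀ rstar := by
    intro x hx
    rw [mem_closedBall, dist_edist] at hx
    exact (ENNReal.le_ofReal_iff_toReal_le (edist_ne_top _ _) hr0).2 hx |>.trans hr
  have hlip : ∀ x ∈ closedBall x₀ r, ∀ y ∈ closedBall x₀ r,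
      ‖(y - A (Φ y)) - (x - A (Φ x))‖ ≤ Z * ‖y - x‖ := fun x hx y hy =>
    (convex_closedBall x₀ r).norm_image_sub_le_of_norm_hasFDerivWithin_le
      (f := fun z => z - A (Φ z))
      (fun z hz => (hasFDerivWithinAt_id z _).sub
        (A.hasFDerivAt.comp_hasFDerivWithinAt z ((hdiff z (hsub hz)).mono hsub)))
      (fun z hz => hZ z (hsub hz)) hx hy
  have hcentre : ‖(x₀ - A (Φ x₀)) - x₀‖ ≤ (1 - Z) * r := by
    rw [div_le_iff₀' (by linarith)] at hYr
    simpa using hY.trans hYr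
  have hzero : ∀ x, Function.IsFixedPt (fun z => z - A (Φ z)) x ↔ Φ x = 0 := fun x => by
    rw [Function.IsFixedPt, sub_eq_self, map_eq_zero_iff A hA]
  simpa only [hzero] using existsUnique_isFixedPt_closedBall hZ0 hZ1 hr0 hlip hcentre
end
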